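/- arXiv:1809.10664 — 12 statements merged into one kernel-verified Lean document; each statement's English description precedes it below -/
import Mathlib

section
/- Let R be a commutative ring, let s ∈ R, and let H_n be an n×n upper Hessenberg matrix over R, i.e. (H_n)_{i,j} = h_{i,j} for j ≥ i (1-based indexing), (H_n)_{i,j} = s for i = j+1, and (H_n)_{i,j} = 0 for i > j+1. For 0 ≤ m ≤ n let Q_m(z) denote the characteristic polynomial det(z·I − H_m) of the leading principal m×m submatrix H_m, with the convention Q_0(z) = 1. Then for every n ≥ 1, Q_n(z) = z·Q_{n−1}(z) − Σ_{k=1}^{n} s^{k−1} · h_{n−k+1,n} · Q_{n−k}(z). -/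
open Polynomial Matrix Finset

/-- The `m × m` leading principal submatrix of an upper Hessenberg matrix with
upper-triangle entries `h i j` (1-based indexing) and subdiagonal entries `s`. -/
def hessenberg {R : Type*} [CommRing R] (s : R) (h : ℕ → ℕ → R) (m : ℕ) :
    Matrix (Fin m) (Fin m) R :=
  Matrix.of fun i j =>
    if (i : ℕ) ≤ (j : ℕ) then h ((i : ℕ) + 1) ((j : ℕ) + 1)
    else if (i : ℕ) = (j : ℕ) + 1 then s else 0

/-- Deleting row `i` from the first `i + d + 1` rows of an upper Hessenberg array with constant
subdiagonal `t` leaves a matrix with determinant `t ^ d` times the `i`-th leading minor. -/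
theorem det_skip_row_of_hessenberg {S : Type*} [CommRing S] (t : S) (f : ℕ → ℕ → S)
    (hsub : ∀ j, f (j + 1) j = t) (hzero : ∀ i j, j + 1 < i → f i j = 0) (i d : ℕ) :
    (Matrix.of fun a b : Fin (i + d) => f (if (a : ℕ) < i then a else a + 1) b).det =
      t ^ d * (Matrix.of fun a b : Fin i => f a b).det := by
  induction d with
  | zero => simp
  | succ d ih =>
    change (Matrix.of fun a b : Fin (i + d + 1) =>
      f (if (a : ℕ) < i then a else a + 1) b).det = _
    rw [det_succ_row _ (Fin.last (i + d)), Fin.sum_univ_castSucc, Finset.sum_eq_zero]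
    · have hminor : ((Matrix.of fun a b : Fin (i + d + 1) =>
          f (if (a : ℕ) < i then a else a + 1) b).submatrix (Fin.last (i + d)).succAbove
          (Fin.last (i + d)).succAbove) =
          Matrix.of fun a b : Fin (i + d) => f (if (a : ℕ) < i then a else a + 1) b := by
        ext a b
        simp
      rw [hminor, ih]
      simp [hsub, pow_succ']
      ring
    · intro b _
      have hb := b.isLt
      simp [hzero (i + d + 1) b (by omega)]

/-- Expansion of the determinant of an upper Hessenberg matrix with constant subdiagonal
along its last column. -/
theorem det_hessenberg_succ {S : Type*} [CommRing S] (t : S) (f : ℕ → ℕ → S)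
    (hsub : ∀ j, f (j + 1) j = t) (hzero : ∀ i j, j + 1 < i → f i j = 0) (m : ℕ) :
    (Matrix.of fun a b : Fin (m + 1) => f a b).det =
      ∑ i ∈ Finset.range (m + 1),
        (-t) ^ (m - i) * f i m * (Matrix.of fun a b : Fin i => f a b).det := by
  rw [det_succ_column _ (Fin.last m), ← Fin.sum_univ_eq_sum_range
    (fun i => (-t) ^ (m - i) * f i m * (Matrix.of fun a b : Fin i => f a b).det)]
  refine Finset.sum_congr rfl fun i _ => ?_
  have hminor : ((Matrix.of fun a b : Fin (m + 1) => f a b).submatrix i.succAbove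
      (Fin.last m).succAbove) =
      Matrix.of fun a b : Fin m => f (if (a : ℕ) < i then a else a + 1) b := by
    ext a b
    simp only [submatrix_apply, of_apply, Fin.succAbove_last, Fin.val_castSucc, Fin.succAbove,
      Fin.lt_def]
    split_ifs <;> simp
  rw [hminor]
  obtain ⟨i, hi⟩ := i
  obtain ⟨d, rfl⟩ := Nat.exists_eq_add_of_le (Nat.lt_succ_iff.mp hi)
  rw [det_skip_row_of_hessenberg t f hsub hzero]
  simp only [of_apply, Fin.val_last, Nat.add_sub_cancel_left]
  have hsign : (-1 : S) ^ (i + (i + d)) = (-1) ^ d := by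
    rw [← add_assoc, pow_add, Even.neg_one_pow ⟨i, rfl⟩, one_mul]
  rw [hsign, neg_pow t]
  ring

/-- The entries of the characteristic matrices of `hessenberg s h m`, as an infinite array. -/
noncomputable def hessenbergCharEntry {R : Type*} [CommRing R] (s : R) (h : ℕ → ℕ → R)
    (i j : ℕ) : R[X] :=
  (if i = j then X else 0) - C (if i ≤ j then h (i + 1) (j + 1) else if i = j + 1 then s else 0)

theorem charpoly_hessenberg_eq_det {R : Type*} [CommRing R] (s : R) (h : ℕ → ℕ → R) (m : ℕ) :
    (hessenberg s h m).charpoly =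
      (Matrix.of fun a b : Fin m => hessenbergCharEntry s h a b).det := by
  rw [Matrix.charpoly]
  congr 1
  ext1 a b
  simp only [charmatrix_apply, hessenberg, hessenbergCharEntry, of_apply, diagonal_apply,
    Fin.ext_iff]

theorem charpoly_hessenberg_rec {R : Type*} [CommRing R] (s : R) (h : ℕ → ℕ → R)
    (n : ℕ) (hn : 1 ≤ n) :
    (hessenberg s h n).charpoly =
      X * (hessenberg s h (n - 1)).charpoly -
        ∑ k ∈ Finset.Icc 1 n,
          C (s ^ (k - 1) * h (n - k + 1) n) * (hessenberg s h (n - k)).charpoly := by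
  obtain ⟨m, rfl⟩ := Nat.exists_eq_add_of_le' hn
  have hsum : ∑ k ∈ Finset.Icc 1 (m + 1),
      C (s ^ (k - 1) * h (m + 1 - k + 1) (m + 1)) * (hessenberg s h (m + 1 - k)).charpoly =
      ∑ i ∈ Finset.range (m + 1),
        C (s ^ (m - i) * h (i + 1) (m + 1)) * (hessenberg s h i).charpoly := by
    refine Finset.sum_nbij' (fun k => m + 1 - k) (fun i => m + 1 - i) ?_ ?_ ?_ ?_ ?_
    · intro k hk
      simp only [Finset.mem_Icc, Finset.mem_range] at *
      omega
    · intro i hi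
      simp only [Finset.mem_Icc, Finset.mem_range] at *
      omega
    · intro k hk
      simp only [Finset.mem_Icc] at *
      omega
    · intro i hi
      simp only [Finset.mem_range] at *
      omega
    · intro k hk
      rw [Finset.mem_Icc] at hk
      rw [show m - (m + 1 - k) = k - 1 by omega]
  rw [hsum, charpoly_hessenberg_eq_det, det_hessenberg_succ (-C s) (hessenbergCharEntry s h)
    (fun j => by simp [hessenbergCharEntry])
    (fun i j hij => by
      simp [hessenbergCharEntry, show i ≠ j by omega, show ¬ i ≤ j by omega,
        show i ≠ j + 1 by omega])]
  simp only [← charpoly_hessenberg_eq_det, neg_neg]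
  have hterm : ∀ i ∈ Finset.range (m + 1),
      C s ^ (m - i) * hessenbergCharEntry s h i m * (hessenberg s h i).charpoly =
      (if i = m then X * (hessenberg s h m).charpoly else 0) -
        C (s ^ (m - i) * h (i + 1) (m + 1)) * (hessenberg s h i).charpoly := by
    intro i hi
    have him : i ≤ m := Nat.lt_succ_iff.mp (Finset.mem_range.mp hi)
    simp only [hessenbergCharEntry, if_pos him, C_mul, C_pow]
    split_ifs with heq
    · subst heq
      simp
      ring
    · ring
  rw [Finset.sum_congr rfl hterm, Finset.sum_sub_distrib]
  simp
end

section
/- Let R be a commutative ring, let s ∈ R, and let H_n be an n×n upper Hessenberg matrix over R with (H_n)_{i,j} = h_{i,j} for j ≥ i, (H_n)_{i,j} = s for i = j+1, and 0 below the subdiagonal. Writing the characteristic polynomial of the leading principal m×m submatrix as Q_m(z) = Σ_{j=0}^{m} q_{m,j} z^j, the coefficients satisfy: q_{n,n} = 1; q_{n,j} = q_{n−1,j−1} − Σ_{k=1}^{n−j} s^{k−1} h_{n−k+1,n} q_{n−k,j} for 1 ≤ j ≤ n−1; q_{n,0} = −Σ_{k=1}^{n} s^{k−1} h_{n−k+1,n}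 q_{n−k,0} for n > 0; and q_{0,0} = 1. -/
open Polynomial Matrix Finset

/-- `q s h m j` is the coefficient of `z^j` in the characteristic polynomial of the
`m × m` upper Hessenberg matrix. -/
noncomputable def q {R : Type*} [CommRing R] (s : R) (h : ℕ → ℕ → R) (m j : ℕ) : R :=
  ((hessenberg s h m).charpoly).coeff j

/-- Expansion along the last column `c` of the determinant of an upper Hessenberg matrix
with constant subdiagonal `-t`. -/
theorem det_hessenberg_updateCol_last {A : Type*} [CommRing A] (t : A) (a : ℕ → ℕ → A)
    (c : ℕ → A) (ha : ∀ i j, j + 1 < i → a i j = 0) (hs : ∀ j, a (j + 1) j = -t) (m : ℕ) :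
    (Matrix.of fun i j : Fin (m + 1) => if (j : ℕ) = m then c i else a i j).det =
      ∑ k ∈ range (m + 1), t ^ k * c (m - k) * (Matrix.of fun i j : Fin (m - k) => a i j).det := by
  induction m with
  | zero => simp
  | succ m ih =>
    rw [Finset.sum_range_succ']
    have hsum : ∑ k ∈ range (m + 1), t ^ (k + 1) * c (m + 1 - (k + 1)) *
          (Matrix.of fun i j : Fin (m + 1 - (k + 1)) => a i j).det =
        t * (Matrix.of fun i j : Fin (m + 1) => if (j : ℕ) = m then c i else a i j).det := by
      rw [ih, Finset.mul_sum]
      refine Finset.sum_congr rfl fun k _ => ?_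
      rw [Nat.add_sub_add_right]
      ring
    rw [hsum, Matrix.det_succ_row _ (Fin.last (m + 1)), Fin.sum_univ_castSucc,
      Fin.sum_univ_castSucc, Finset.sum_eq_zero, zero_add]
    · congr 1
      · have hminor : (Matrix.of fun i j : Fin (m + 1 + 1) =>
            if (j : ℕ) = m + 1 then c i else a i j).submatrix (Fin.last (m + 1)).succAbove
              (Fin.last m).castSucc.succAbove =
            Matrix.of fun i j : Fin (m + 1) => if (j : ℕ) = m then c i else a i j := by
          ext i j
          induction j using Fin.lastCases with
          | last => simp
          | cast j =>
            have hj : (Fin.last m).castSucc.succAbove j.castSucc = j.castSucc.castSucc :=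
              Fin.succAbove_of_castSucc_lt _ _ (by simp [Fin.lt_def])
            simp [hj, j.isLt.ne, (j.isLt.trans (Nat.lt_succ_self m)).ne]
        rw [hminor]
        have hsign : (-1 : A) ^ (m + 1 + m) = -1 := Odd.neg_one_pow ⟨m, by ring⟩
        simp [hs, hsign]
      · have hminor : (Matrix.of fun i j : Fin (m + 1 + 1) =>
            if (j : ℕ) = m + 1 then c i else a i j).submatrix (Fin.last (m + 1)).succAbove
              (Fin.last (m + 1)).succAbove = Matrix.of fun i j : Fin (m + 1) => a i j := by
          ext i j
          simp [j.isLt.ne]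
        rw [hminor]
        have hsign : (-1 : A) ^ (m + 1 + (m + 1)) = 1 := Even.neg_one_pow ⟨m + 1, rfl⟩
        simp [hsign]
    · intro j _
      have hj : (j : ℕ) ≠ m + 1 := by omega
      simp [hj, ha (m + 1) j (by omega)]

theorem charmatrix_hessenberg {R : Type*} [CommRing R] (s : R) (h : ℕ → ℕ → R) (m : ℕ) :
    (hessenberg s h m).charmatrix =
      Matrix.of fun i j : Fin m => hessenbergCharEntry s h i j := by
  ext1 i j
  simp [Matrix.charmatrix_apply, Matrix.diagonal_apply, hessenberg, hessenbergCharEntry,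
    Fin.ext_iff]

theorem charpoly_hessenberg_succ {R : Type*} [CommRing R] (s : R) (h : ℕ → ℕ → R) (m : ℕ) :
    (hessenberg s h (m + 1)).charpoly = X * (hessenberg s h m).charpoly -
      ∑ k ∈ range (m + 1),
        C (s ^ k * h (m - k + 1) (m + 1)) * (hessenberg s h (m - k)).charpoly := by
  have hcol : (hessenberg s h (m + 1)).charmatrix = Matrix.of fun i j : Fin (m + 1) =>
      if (j : ℕ) = m then hessenbergCharEntry s h i m else hessenbergCharEntry s h i j := by
    rw [charmatrix_hessenberg]
    ext1 i j
    simp only [Matrix.of_apply]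
    split_ifs with hj
    · rw [hj]
    · rfl
  rw [Matrix.charpoly, hcol, det_hessenberg_updateCol_last (C s) (hessenbergCharEntry s h)
    (fun i => hessenbergCharEntry s h i m)]
  · have hterm : ∀ k ∈ range (m + 1), C s ^ k * hessenbergCharEntry s h (m - k) m *
          (Matrix.of fun i j : Fin (m - k) => hessenbergCharEntry s h i j).det =
        (if k = 0 then X * (hessenberg s h m).charpoly else 0) -
          C (s ^ k * h (m - k + 1) (m + 1)) * (hessenberg s h (m - k)).charpoly := by
      intro k hk
      rw [← charmatrix_hessenberg, ← Matrix.charpoly]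
      have hkm : m - k = m ↔ k = 0 := by
        have := Finset.mem_range.mp hk
        omega
      simp only [hessenbergCharEntry, hkm, Nat.sub_le, if_true, map_mul, map_pow]
      split_ifs with h0
      · subst h0
        simp only [Nat.sub_zero]
        ring
      · ring
    rw [Finset.sum_congr rfl hterm, Finset.sum_sub_distrib]
    simp
  · intro i j hij
    simp [hessenbergCharEntry, show i ≠ j by omega, show ¬ i ≤ j by omega,
      show i ≠ j + 1 by omega]
  · intro j
    simp [hessenbergCharEntry]

theorem q_self {R : Type*} [CommRing R] (s : R) (h : ℕ → ℕ → R) (n : ℕ) : q s h n n = 1 := by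
  nontriviality R
  have hdeg := (hessenberg s h n).charpoly_natDegree_eq_dim
  have hmonic := (hessenberg s h n).charpoly_monic.coeff_natDegree
  rwa [hdeg, Fintype.card_fin] at hmonic

theorem q_eq_zero_of_lt {R : Type*} [CommRing R] (s : R) (h : ℕ → ℕ → R) {n j : ℕ}
    (hj : n < j) : q s h n j = 0 := by
  nontriviality R
  apply coeff_eq_zero_of_natDegree_lt
  rwa [Matrix.charpoly_natDegree_eq_dim, Fintype.card_fin]

theorem q_succ {R : Type*} [CommRing R] (s : R) (h : ℕ → ℕ → R) (m j : ℕ) :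
    q s h (m + 1) j = (X * (hessenberg s h m).charpoly).coeff j -
      ∑ k ∈ Finset.Icc 1 (m + 1),
        s ^ (k - 1) * h (m + 1 - k + 1) (m + 1) * q s h (m + 1 - k) j := by
  rw [q, charpoly_hessenberg_succ, coeff_sub, finsetSum_coeff, ← Finset.Ico_add_one_right_eq_Icc,
    Finset.sum_Ico_eq_sum_range]
  congr 1
  refine Finset.sum_congr rfl fun k _ => ?_
  rw [coeff_C_mul, q, Nat.add_sub_cancel_left, add_comm 1 k, Nat.add_sub_add_right]

theorem charpoly_hessenberg_coeff_rec {R : Type*} [CommRing R] (s : R) (h : ℕ → ℕ → R) :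
    (∀ n : ℕ, q s h n n = 1) ∧
    (∀ n j : ℕ, 1 ≤ j → j ≤ n - 1 →
      q s h n j = q s h (n - 1) (j - 1) -
        ∑ k ∈ Finset.Icc 1 (n - j), s ^ (k - 1) * h (n - k + 1) n * q s h (n - k) j) ∧
    (∀ n : ℕ, 0 < n →
      q s h n 0 = -∑ k ∈ Finset.Icc 1 n, s ^ (k - 1) * h (n - k + 1) n * q s h (n - k) 0) ∧
    q s h 0 0 = 1 := by
  refine ⟨q_self s h, ?_, ?_, q_self s h 0⟩
  · intro n j hj hjn
    obtain ⟨m, rfl⟩ : ∃ m, n = m + 1 := ⟨n - 1, by omega⟩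
    obtain ⟨i, rfl⟩ : ∃ i, j = i + 1 := ⟨j - 1, by omega⟩
    rw [q_succ, coeff_X_mul]
    simp only [Nat.add_sub_cancel]
    congr 1
    symm
    apply Finset.sum_subset (Finset.Icc_subset_Icc_right (by omega))
    intro k hk hk'
    simp only [Finset.mem_Icc] at hk hk'
    rw [q_eq_zero_of_lt s h (by omega), mul_zero]
  · intro n hn
    obtain ⟨m, rfl⟩ : ∃ m, n = m + 1 := ⟨n - 1, by omega⟩
    rw [q_succ, coeff_X_mul_zero, zero_sub]
end

section
/- For every t : ℕ → ℤ, the coefficients p_{n,j} of the characteristic polynomials of the matrices M_n(t) satisfy: p_{n,n} = 1; p_{n,j} = p_{n−1,j−1} − Σ_{k=1}^{n−j} t(k)·p_{n−k,j} for 1 ≤ j ≤ n−1; p_{n,0} = −Σ_{k=1}^{n} t(k)·p_{n−k,0} for n > 0; and p_{0,0} = 1. -/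
open Polynomial Matrix Finset

/-- The `n × n` upper Hessenberg Toeplitz matrix with entries `t (j - i + 1)` on and above
the diagonal (1-based indexing), `1` on the subdiagonal, and `0` below. -/
def uht (t : ℕ → ℤ) (n : ℕ) : Matrix (Fin n) (Fin n) ℤ :=
  Matrix.of fun i j =>
    if (i : ℕ) ≤ (j : ℕ) then t ((j : ℕ) - (i : ℕ) + 1)
    else if (i : ℕ) = (j : ℕ) + 1 then 1 else 0

/-- `p t n k` is the coefficient of `z^k` in the characteristic polynomial of `uht t n`. -/
noncomputable def p (t : ℕ → ℤ) (n k : ℕ) : ℤ := ((uht t n).charpoly).coeff k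

/-- The upper Hessenberg matrix with first row `a`, whose other rows are those of the Toeplitz
matrix with entries `c (j - i)` on and above the diagonal and `-1` on the subdiagonal. -/
def borderedHessenberg {R : Type*} [Ring R] (a c : ℕ → R) (n : ℕ) : Matrix (Fin n) (Fin n) R :=
  Matrix.of fun i j =>
    if (i : ℕ) = 0 then a j
    else if (i : ℕ) ≤ (j : ℕ) then c ((j : ℕ) - (i : ℕ))
    else if (i : ℕ) = (j : ℕ) + 1 then -1 else 0

theorem det_borderedHessenberg_succ_succ {R : Type*} [CommRing R] (a c : ℕ → R) (n : ℕ) :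
    (borderedHessenberg a c (n + 2)).det =
      a 0 * (borderedHessenberg c c (n + 1)).det +
        (borderedHessenberg (fun k => a (k + 1)) c (n + 1)).det := by
  have h₀ : (borderedHessenberg a c (n + 2)).submatrix (Fin.succAbove 0) Fin.succ =
      borderedHessenberg c c (n + 1) := by
    ext i j
    simp only [borderedHessenberg, submatrix_apply, of_apply, Fin.succAbove_zero, Fin.val_succ]
    split_ifs <;> first | contradiction | omega | rfl | (congr 1; omega)
  have h₁ : (borderedHessenberg a c (n + 2)).submatrix (Fin.succAbove (Fin.succ 0)) Fin.succ =
      borderedHessenberg (fun k => a (k + 1)) c (n + 1) := by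
    ext i j
    refine Fin.cases ?_ (fun i => ?_) i
    · simp [borderedHessenberg]
    · simp only [borderedHessenberg, submatrix_apply, of_apply, Fin.succ_succAbove_succ,
        Fin.succAbove_zero, Fin.val_succ]
      split_ifs <;> first | omega | rfl | (congr 1; omega)
  rw [det_succ_column_zero, Fin.sum_univ_succ, Fin.sum_univ_succ, h₀, h₁, Finset.sum_eq_zero]
  · simp [borderedHessenberg]
  · intro i _
    simp [borderedHessenberg]

theorem det_borderedHessenberg_succ {R : Type*} [CommRing R] (a c : ℕ → R) (n : ℕ) :
    (borderedHessenberg a c (n + 1)).det =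
      ∑ k ∈ Finset.range (n + 1), a k * (borderedHessenberg c c (n - k)).det := by
  induction n generalizing a with
  | zero => simp [borderedHessenberg]
  | succ n ih =>
    rw [det_borderedHessenberg_succ_succ, ih fun k => a (k + 1), Finset.sum_range_succ' _ (n + 1), add_comm]
    refine congrArg (· + _) (Finset.sum_congr rfl fun k _ => ?_)
    rw [Nat.add_sub_add_right]

theorem charmatrix_uht (t : ℕ → ℤ) (n : ℕ) :
    (uht t n).charmatrix =
      borderedHessenberg (fun k => (if k = 0 then X else 0) - C (t (k + 1)))
        (fun k => (if k = 0 then X else 0) - C (t (k + 1))) n := by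
  ext1 i j
  simp only [charmatrix_apply, borderedHessenberg, uht, of_apply, diagonal_apply, Fin.ext_iff]
  split_ifs <;> first | omega | simp_all

theorem charpoly_uht_succ (t : ℕ → ℤ) (n : ℕ) :
    (uht t (n + 1)).charpoly = X * (uht t n).charpoly -
      ∑ k ∈ Finset.Icc 1 (n + 1), C (t k) * (uht t (n + 1 - k)).charpoly := by
  have h : ∑ k ∈ Finset.Icc 1 (n + 1), C (t k) * (uht t (n + 1 - k)).charpoly =
      ∑ k ∈ Finset.range (n + 1), C (t (k + 1)) * (uht t (n - k)).charpoly := by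
    rw [← Finset.Ico_add_one_right_eq_Icc, Finset.sum_Ico_eq_sum_range]
    refine Finset.sum_congr rfl fun k _ => ?_
    rw [add_comm 1 k, Nat.add_sub_add_right]
  rw [h, Matrix.charpoly, charmatrix_uht, det_borderedHessenberg_succ]
  simp only [← charmatrix_uht, ← Matrix.charpoly.eq_1, sub_mul, Finset.sum_sub_distrib]
  simp

theorem p_self (t : ℕ → ℤ) (n : ℕ) : p t n n = 1 := by
  have h := (uht t n).charpoly_monic.coeff_natDegree
  rwa [charpoly_natDegree_eq_dim, Fintype.card_fin] at h

theorem p_eq_zero_of_lt (t : ℕ → ℤ) {n k : ℕ} (h : n < k) : p t n k = 0 :=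
  coeff_eq_zero_of_natDegree_lt (by rwa [charpoly_natDegree_eq_dim, Fintype.card_fin])

theorem uht_charpoly_coeff_rec (t : ℕ → ℤ) :
    (∀ n : ℕ, p t n n = 1) ∧
    (∀ n j : ℕ, 1 ≤ j → j ≤ n - 1 →
      p t n j = p t (n - 1) (j - 1) - ∑ k ∈ Finset.Icc 1 (n - j), t k * p t (n - k) j) ∧
    (∀ n : ℕ, 0 < n → p t n 0 = -∑ k ∈ Finset.Icc 1 n, t k * p t (n - k) 0) ∧
    p t 0 0 = 1 := by
  refine ⟨p_self t, fun n j hj hjn => ?_, fun n hn => ?_, p_self t 0⟩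
  · obtain ⟨n, rfl⟩ : ∃ m, n = m + 1 := ⟨n - 1, by omega⟩
    obtain ⟨j, rfl⟩ : ∃ m, j = m + 1 := ⟨j - 1, by omega⟩
    have h : ∑ k ∈ Finset.Icc 1 (n + 1 - (j + 1)), t k * p t (n + 1 - k) (j + 1) =
        ∑ k ∈ Finset.Icc 1 (n + 1), t k * p t (n + 1 - k) (j + 1) := by
      refine Finset.sum_subset (Finset.Icc_subset_Icc_right (by omega)) fun k hk hk' => ?_
      rw [Finset.mem_Icc] at hk hk'
      rw [p_eq_zero_of_lt t (by omega), mul_zero]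
    rw [h]
    simp [p, charpoly_uht_succ t n]
  · obtain ⟨n, rfl⟩ : ∃ m, n = m + 1 := ⟨n - 1, by omega⟩
    simp [p, charpoly_uht_succ t n]
end

section
/- For every n ≥ 0 and 0 ≤ i ≤ n, the coefficient p_{n,i} of z^i in the characteristic polynomial of M_n(t) depends only on the values t(1), …, t(n−i): if t, t' : ℕ → ℤ satisfy t(j) = t'(j) for all 1 ≤ j ≤ n−i, then the coefficient of z^i in the characteristic polynomial of M_n(t) equals the coefficient of z^i in the characteristic polynomial of M_n(t'). -/
open Polynomial Matrix Finset

theorem natDegree_charmatrix_le {R n : Type*} [CommRing R] [Fintype n] [DecidableEq n]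
    (M : Matrix n n R) (i j : n) :
    (charmatrix M i j).natDegree ≤ if i = j then 1 else 0 := by
  split_ifs with hij
  · subst hij
    rw [charmatrix_apply_eq]
    exact natDegree_X_sub_C_le _
  · rw [charmatrix_apply_ne _ _ _ hij, natDegree_neg, natDegree_C]

theorem charmatrix_uht_eq_zero (t : ℕ → ℤ) {n : ℕ} {a b : Fin n} (hab : (b : ℕ) + 1 < a) :
    charmatrix (uht t n) a b = 0 := by
  have hne : a ≠ b := by
    rintro rfl
    omega
  have hle : ¬ (a : ℕ) ≤ b := by omega
  rw [charmatrix_apply_ne _ _ _ hne, uht, of_apply, if_neg hle, if_neg hab.ne', C_0, neg_zero]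

/-- A term of the Leibniz expansion that uses an entry `c` places above the diagonal also uses
at least `c` subdiagonal entries, so it has degree less than `n - c`. -/
theorem coeff_prod_charmatrix_uht_eq_zero (t : ℕ → ℤ) {n i : ℕ} (σ : Equiv.Perm (Fin n))
    (b : Fin n) (hb : σ b < b) (hi : n ≤ i + (b - σ b : ℕ)) :
    (∏ l, charmatrix (uht t n) (σ l) l).coeff i = 0 := by
  by_cases hσ : ∃ l : Fin n, (l : ℕ) + 1 < σ l
  · obtain ⟨l, hl⟩ := hσ
    have hprod : ∏ l, charmatrix (uht t n) (σ l) l = 0 :=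
      Finset.prod_eq_zero (Finset.mem_univ l) (charmatrix_uht_eq_zero t hl)
    rw [hprod, coeff_zero]
  push Not at hσ
  apply coeff_eq_zero_of_natDegree_lt
  refine (natDegree_prod_le _ _).trans_lt ?_
  refine (Finset.sum_le_sum fun l _ => natDegree_charmatrix_le (uht t n) (σ l) l).trans_lt ?_
  have hsum : ∑ l : Fin n, ((σ l : ℕ) : ℤ) = ∑ l : Fin n, ((l : ℕ) : ℤ) :=
    Equiv.sum_comp σ fun l : Fin n => ((l : ℕ) : ℤ)
  have hle : ∑ l : Fin n, (if σ l = l then 1 else 0 : ℤ) ≤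
      ∑ l : Fin n, (1 + (((l : ℕ) : ℤ) - (σ l : ℕ)) -
        if l = b then 1 + (((b : ℕ) : ℤ) - (σ b : ℕ)) else 0) := by
    refine Finset.sum_le_sum fun l _ => ?_
    have hl := hσ l
    by_cases hlb : l = b
    · subst hlb
      simp [hb.ne]
    · simp only [hlb, if_false, Fin.ext_iff]
      split_ifs <;> omega
  simp only [Finset.sum_sub_distrib, Finset.sum_add_distrib, hsum, Finset.sum_ite_eq',
    Finset.mem_univ, if_true, Finset.sum_const, Finset.card_univ, Fintype.card_fin] at hle
  zify
  have hb' : (σ b : ℕ) < b := hb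
  simp at hle ⊢
  omega

theorem uht_charpoly_coeff_depends_only_on_first (n i : ℕ) (hi : i ≤ n)
    (t t' : ℕ → ℤ) (h : ∀ j : ℕ, 1 ≤ j → j ≤ n - i → t j = t' j) :
    ((uht t n).charpoly).coeff i = ((uht t' n).charpoly).coeff i := by
  obtain rfl | hlt := hi.eq_or_lt
  · have hmonic (s : ℕ → ℤ) : ((uht s i).charpoly).coeff i = 1 := by
      have := (charpoly_monic (uht s i)).coeff_natDegree
      rwa [charpoly_natDegree_eq_dim, Fintype.card_fin] at this
    rw [hmonic, hmonic]
  simp only [Matrix.charpoly, det_apply, finsetSum_coeff, coeff_smul]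
  refine Finset.sum_congr rfl fun σ _ => congrArg _ ?_
  by_cases hσ : ∃ b, σ b < b ∧ n ≤ i + (b - σ b : ℕ)
  · obtain ⟨b, hb, hbi⟩ := hσ
    rw [coeff_prod_charmatrix_uht_eq_zero t σ b hb hbi,
      coeff_prod_charmatrix_uht_eq_zero t' σ b hb hbi]
  · push Not at hσ
    congr 1
    refine Finset.prod_congr rfl fun l _ => ?_
    have hl := hσ l
    rw [Fin.lt_def] at hl
    rw [charmatrix_apply, charmatrix_apply]
    congr 2
    simp only [uht, of_apply]
    split_ifs
    · exact h _ (by omega) (by omega)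
    all_goals rfl
end

section
/- For every n ≥ 1, the map sending t : {1,…,n} → {−1,0,+1} to the characteristic polynomial of M_n(t) is injective; consequently, the set of characteristic polynomials of all n×n upper Hessenberg Toeplitz matrices with subdiagonal entries 1 and entries t(k) ∈ {−1,0,+1} has cardinality exactly 3^n. -/
open Polynomial Matrix Finset

/-- The `n × n` upper Hessenberg Toeplitz matrix determined by `t : Fin n → ℤ`:
the entry in row `i`, column `j` (0-based) is `t (j - i)` when `j ≥ i`
(so the diagonal is `t 0`, corresponding to `t₁` in 1-based notation),
`1` on the subdiagonal, and `0` below the subdiagonal. -/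
def uhtFin (n : ℕ) (t : Fin n → ℤ) : Matrix (Fin n) (Fin n) ℤ :=
  Matrix.of fun i j =>
    if (i : ℕ) ≤ (j : ℕ) then
      t ⟨(j : ℕ) - (i : ℕ), lt_of_le_of_lt (Nat.sub_le _ _) j.isLt⟩
    else if (i : ℕ) = (j : ℕ) + 1 then 1 else 0

/-- The `n × n` upper Hessenberg Toeplitz matrix with subdiagonal entries `-1` and `c (j - i)`
on and above the diagonal. -/
def toeplitzHessenberg {R : Type*} [CommRing R] (c : ℕ → R) (n : ℕ) : Matrix (Fin n) (Fin n) R :=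
  Matrix.of fun i j =>
    if (i : ℕ) ≤ (j : ℕ) then c ((j : ℕ) - (i : ℕ)) else if (i : ℕ) = (j : ℕ) + 1 then -1 else 0

/-- The matrix `toeplitzHessenberg c (n + 1)` with its first row replaced by `a`. -/
def toeplitzHessenbergRow {R : Type*} [CommRing R] (a c : ℕ → R) (n : ℕ) :
    Matrix (Fin (n + 1)) (Fin (n + 1)) R :=
  Matrix.of fun i j => if i = 0 then a j else toeplitzHessenberg c (n + 1) i j

theorem det_toeplitzHessenbergRow {R : Type*} [CommRing R] (a c : ℕ → R) (n : ℕ) :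
    (toeplitzHessenbergRow a c n).det =
      ∑ j ∈ Finset.range (n + 1), a j * (toeplitzHessenberg c (n - j)).det := by
  induction n generalizing a with
  | zero => simp [toeplitzHessenbergRow]
  | succ n ih =>
    rw [Matrix.det_succ_column_zero, Fin.sum_univ_succ, Fin.sum_univ_succ,
      Finset.sum_range_succ']
    have h_tail : ∀ i : Fin n, toeplitzHessenbergRow a c (n + 1) i.succ.succ 0 = 0 := by
      intro i
      simp [toeplitzHessenbergRow, toeplitzHessenberg]
    have h_head : (toeplitzHessenbergRow a c (n + 1)).submatrix (Fin.succAbove 0) Fin.succ =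
        toeplitzHessenberg c (n + 1) := by
      ext i j
      simp [toeplitzHessenbergRow, toeplitzHessenberg]
    have h_shift : (toeplitzHessenbergRow a c (n + 1)).submatrix
        (Fin.succAbove (Fin.succ 0)) Fin.succ =
        toeplitzHessenbergRow (fun j => a (j + 1)) c n := by
      ext i j
      refine Fin.cases ?_ (fun i => ?_) i
      · simp [toeplitzHessenbergRow]
      · rw [Matrix.submatrix_apply, Fin.succ_succAbove_succ, Fin.succAbove_zero]
        simp [toeplitzHessenbergRow, toeplitzHessenberg]
    have h_zero : toeplitzHessenbergRow a c (n + 1) 0 0 = a 0 := by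
      simp [toeplitzHessenbergRow]
    have h_one : toeplitzHessenbergRow a c (n + 1) (Fin.succ 0) 0 = -1 := by
      simp [toeplitzHessenbergRow, toeplitzHessenberg]
    rw [h_head, h_shift, ih, h_zero, h_one]
    have h_index : ∀ j, (toeplitzHessenberg c (n + 1 - (j + 1))).det =
        (toeplitzHessenberg c (n - j)).det := by
      intro j
      rw [Nat.add_sub_add_right]
    simp only [h_tail, h_index, Fin.val_zero, Fin.val_succ]
    simp only [mul_zero, zero_mul, Finset.sum_const_zero, Nat.sub_zero]
    ring

theorem det_toeplitzHessenberg_succ {R : Type*} [CommRing R] (c : ℕ → R) (n : ℕ) :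
    (toeplitzHessenberg c (n + 1)).det =
      ∑ j ∈ Finset.range (n + 1), c j * (toeplitzHessenberg c (n - j)).det := by
  rw [← det_toeplitzHessenbergRow]
  congr 1
  ext i j
  by_cases hi : i = 0 <;> simp [toeplitzHessenbergRow, toeplitzHessenberg, hi]

theorem uhtFin_charpoly_eq_det (t : ℕ → ℤ) (n : ℕ) :
    (uhtFin n fun k => t k).charpoly =
      (toeplitzHessenberg (fun j => (if j = 0 then X else 0) - C (t j)) n).det := by
  rw [Matrix.charpoly]
  congr 1
  ext1 i j
  rw [Matrix.charmatrix_apply, Matrix.diagonal_apply]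
  simp only [uhtFin, toeplitzHessenberg, Matrix.of_apply, Fin.ext_iff]
  rcases lt_trichotomy (i : ℕ) (j : ℕ) with h | h | h
  · simp [h.le, h.ne, Nat.sub_ne_zero_of_lt h]
  · simp [h]
  · by_cases h' : (i : ℕ) = (j : ℕ) + 1 <;> simp [h.not_ge, h.ne', h']

theorem uhtFin_charpoly_succ (t : ℕ → ℤ) (n : ℕ) :
    (uhtFin (n + 1) fun k => t k).charpoly =
      X * (uhtFin n fun k => t k).charpoly -
        ∑ j ∈ Finset.range (n + 1), C (t j) * (uhtFin (n - j) fun k => t k).charpoly := by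
  simp only [uhtFin_charpoly_eq_det, det_toeplitzHessenberg_succ, sub_mul,
    Finset.sum_sub_distrib]
  congr 1
  rw [Finset.sum_eq_single 0] <;> simp +contextual

theorem uhtFin_charpoly_coeff_of_le (t : ℕ → ℤ) {n m : ℕ} (h : n ≤ m) :
    (uhtFin n fun k => t k).charpoly.coeff m = if n = m then 1 else 0 := by
  have hd : (uhtFin n fun k => t k).charpoly.natDegree = n := by
    simp [Matrix.charpoly_natDegree_eq_dim]
  split_ifs with hnm
  · subst hnm
    have := (Matrix.charpoly_monic (uhtFin n fun k => t k)).coeff_natDegree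
    rwa [hd] at this
  · exact coeff_eq_zero_of_natDegree_lt (by omega)

/-- If two entry sequences agree below `k`, then the characteristic polynomials first differ
in codimension `k + 1`, and there the difference is a nonzero multiple of `t k - s k`. -/
theorem uhtFin_charpoly_coeff_sub (t s : ℕ → ℤ) (k : ℕ) (hts : ∀ j < k, t j = s j) (n m : ℕ)
    (h : n ≤ m + k + 1) :
    (uhtFin n fun k => t k).charpoly.coeff m - (uhtFin n fun k => s k).charpoly.coeff m =
      if n = m + k + 1 then -((m : ℤ) + 1) * (t k - s k) else 0 := by
  induction n using Nat.strong_induction_on generalizing m with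
  | _ n ih =>
  cases n with
  | zero => simp [Matrix.charpoly]
  | succ n =>
    have h_sum : ∑ j ∈ Finset.range (n + 1),
        (t j * (uhtFin (n - j) fun k => t k).charpoly.coeff m -
          s j * (uhtFin (n - j) fun k => s k).charpoly.coeff m) =
        if n = m + k then t k - s k else 0 := by
      have h_term : ∀ j ∈ Finset.range (n + 1),
          (t j * (uhtFin (n - j) fun k => t k).charpoly.coeff m -
            s j * (uhtFin (n - j) fun k => s k).charpoly.coeff m) =
          if j = k then (if n = m + k then t k - s k else 0) else 0 := by
        intro j hj
        rw [Finset.mem_range] at hj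
        rcases lt_or_ge j k with hjk | hjk
        · have := ih (n - j) (by omega) m (by omega)
          rw [if_neg (by omega)] at this
          rw [if_neg hjk.ne, hts j hjk, ← mul_sub, this, mul_zero]
        · rw [uhtFin_charpoly_coeff_of_le t (by omega), uhtFin_charpoly_coeff_of_le s (by omega)]
          by_cases hjk' : j = k
          · subst hjk'
            by_cases hn : n = m + j
            · simp [hn]
            · rw [if_neg (by omega), if_pos rfl, if_neg hn]
              simp
          · rw [if_neg (by omega), if_neg hjk']
            simp
      rw [Finset.sum_congr rfl h_term, Finset.sum_ite_eq']
      split_ifs with h₁ h₂ h₃ <;> first | rfl | (simp at h₁; omega)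
    rw [Finset.sum_sub_distrib] at h_sum
    simp only [uhtFin_charpoly_succ, coeff_sub, finsetSum_coeff, coeff_C_mul]
    cases m with
    | zero =>
      simp only [coeff_X_mul_zero]
      have : n + 1 = 0 + k + 1 ↔ n = 0 + k := by omega
      simp only [this]
      split_ifs at h_sum ⊢ <;> push_cast <;> linarith
    | succ m =>
      simp only [coeff_X_mul]
      have := ih n (by omega) m (by omega)
      have h₁ : n + 1 = m + 1 + k + 1 ↔ n = m + 1 + k := by omega
      have h₂ : n = m + k + 1 ↔ n = m + 1 + k := by omega
      simp only [h₁]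
      simp only [h₂] at this
      split_ifs at h_sum this ⊢ <;> push_cast <;> linarith

theorem uhtFin_charpoly_injective (n : ℕ) :
    Function.Injective fun t : Fin n → ℤ => (uhtFin n t).charpoly := by
  intro t s hts
  let extend : (Fin n → ℤ) → ℕ → ℤ := fun u k => if h : k < n then u ⟨k, h⟩ else 0
  have h_extend : ∀ u, (fun k : Fin n => extend u k) = u := by
    intro u
    ext k
    simp [extend]
  have h_eq : ∀ k < n, extend t k = extend s k := by
    intro k
    induction k using Nat.strong_induction_on with
    | _ k ih =>
    intro hk
    have h := uhtFin_charpoly_coeff_sub (extend t) (extend s) k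
      (fun j hj => ih j hj (hj.trans hk)) n (n - (k + 1)) (by omega)
    rw [h_extend, h_extend, if_pos (by omega)] at h
    simp only at hts
    rw [hts, sub_self, eq_comm, mul_eq_zero] at h
    rcases h with h | h <;> omega
  rw [← h_extend t, ← h_extend s]
  exact funext fun k => h_eq k k.isLt

theorem uht_charpoly_injective_card (n : ℕ) (hn : 1 ≤ n) :
    Set.InjOn (fun t : Fin n → ℤ => (uhtFin n t).charpoly)
      {t | ∀ k, t k ∈ ({-1, 0, 1} : Set ℤ)} ∧
    ((fun t : Fin n → ℤ => (uhtFin n t).charpoly) ''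
      {t | ∀ k, t k ∈ ({-1, 0, 1} : Set ℤ)}).ncard = 3 ^ n := by
  have h_inj := (uhtFin_charpoly_injective n).injOn
    (s := {t : Fin n → ℤ | ∀ k, t k ∈ ({-1, 0, 1} : Set ℤ)})
  refine ⟨h_inj, ?_⟩
  rw [h_inj.ncard_image]
  have h_set : {t : Fin n → ℤ | ∀ k, t k ∈ ({-1, 0, 1} : Set ℤ)} =
      (Fintype.piFinset fun _ : Fin n => ({-1, 0, 1} : Finset ℤ) : Set (Fin n → ℤ)) := by
    ext t
    simp
  rw [h_set, Set.ncard_coe_finset, Fintype.card_piFinset]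
  simp
end

section
/- Let F ⊂ ℝ be a nonempty finite set with at least two elements, let a = min F and b = max F, and suppose |a| ≥ |b|. Then for every n ≥ 1 and every t : ℕ → ℝ with t(k) ∈ F for all k, the characteristic height of M_n(t) is at most the characteristic height of M_n(t_a), where t_a(k) = a for all k. -/
open Polynomial Matrix Finset

/-- The `n × n` upper Hessenberg Toeplitz matrix over ℝ with entries `t (j - i + 1)` on and
above the diagonal (1-based indexing), `1` on the subdiagonal, and `0` below. -/
def uhtR (t : ℕ → ℝ) (n : ℕ) : Matrix (Fin n) (Fin n) ℝ :=
  Matrix.of fun i j =>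
    if (i : ℕ) ≤ (j : ℕ) then t ((j : ℕ) - (i : ℕ) + 1)
    else if (i : ℕ) = (j : ℕ) + 1 then 1 else 0

/-- The height of a real polynomial: the supremum of the absolute values of
its coefficients. -/
noncomputable def heightR (p : Polynomial ℝ) : ℝ :=
  ⨆ k : ℕ, |p.coeff k|

/-- The entries of `z • 1 - M` for the Hessenberg Toeplitz matrix `M`, indexed by `ℕ`. -/
noncomputable def uhtCharEntry (t : ℕ → ℝ) (i j : ℕ) : ℝ[X] :=
  (if i = j then X else 0) - C (if i ≤ j then t (j - i + 1) else if i = j + 1 then 1 else 0)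

/-- The characteristic matrix of `uhtR t (n + 1)` with its first row replaced by `r`. -/
noncomputable def uhtCharRow (t : ℕ → ℝ) (r : ℕ → ℝ[X]) (n : ℕ) :
    Matrix (Fin (n + 1)) (Fin (n + 1)) ℝ[X] :=
  Matrix.of fun i j => if (i : ℕ) = 0 then r j else uhtCharEntry t i j

/-- `q` dominates `p` coefficientwise in absolute value. -/
def CoeffDominated (p q : ℝ[X]) : Prop :=
  ∀ k, |p.coeff k| ≤ q.coeff k

theorem CoeffDominated.add {p q p' q' : ℝ[X]} (h : CoeffDominated p q)
    (h' : CoeffDominated p' q') : CoeffDominated (p + p') (q + q') := fun k => by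
  simpa only [coeff_add] using (abs_add_le _ _).trans (add_le_add (h k) (h' k))

theorem CoeffDominated.mul {p q p' q' : ℝ[X]} (h : CoeffDominated p q)
    (h' : CoeffDominated p' q') : CoeffDominated (p * p') (q * q') := fun k => by
  simp only [coeff_mul]
  refine (Finset.abs_sum_le_sum_abs _ _).trans (Finset.sum_le_sum fun x _ => ?_)
  rw [abs_mul]
  exact mul_le_mul (h _) (h' _) (abs_nonneg _) ((abs_nonneg _).trans (h _))

theorem uhtCharEntry_succ_succ (t : ℕ → ℝ) (i j : ℕ) :
    uhtCharEntry t (i + 1) (j + 1) = uhtCharEntry t i j := by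
  simp [uhtCharEntry]

theorem charpoly_uhtR_succ (t : ℕ → ℝ) (n : ℕ) :
    (uhtR t (n + 1)).charpoly = (uhtCharRow t (uhtCharEntry t 0) n).det := by
  rw [Matrix.charpoly]
  congr 1
  ext1 i j
  have h : uhtCharRow t (uhtCharEntry t 0) n i j = uhtCharEntry t i j := by
    rw [uhtCharRow, Matrix.of_apply]
    split_ifs with h
    · rw [h]
    · rfl
  simp only [h, uhtCharEntry, Matrix.charmatrix_apply, Matrix.diagonal_apply, uhtR,
    Matrix.of_apply, Fin.ext_iff]

theorem det_uhtCharRow_zero (t : ℕ → ℝ) (r : ℕ → ℝ[X]) : (uhtCharRow t r 0).det = r 0 := by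
  simp [uhtCharRow]

theorem det_uhtCharRow_succ (t : ℕ → ℝ) (r : ℕ → ℝ[X]) (n : ℕ) :
    (uhtCharRow t r (n + 1)).det =
      r 0 * (uhtCharRow t (uhtCharEntry t 0) n).det +
        (uhtCharRow t (fun j => r (j + 1)) n).det := by
  rw [Matrix.det_succ_column_zero, Fin.sum_univ_succ, Fin.sum_univ_succ,
    Finset.sum_eq_zero, add_zero]
  · have h₁ : (uhtCharRow t r (n + 1)).submatrix (Fin.succAbove 0) Fin.succ =
        uhtCharRow t (uhtCharEntry t 0) n := by
      ext1 i j
      simp only [uhtCharRow, Matrix.submatrix_apply, Matrix.of_apply, Fin.zero_succAbove,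
        Fin.val_succ, uhtCharEntry_succ_succ]
      split_ifs with h₁ h₂ <;> simp_all
    have h₂ : (uhtCharRow t r (n + 1)).submatrix (Fin.succAbove (Fin.succ 0)) Fin.succ =
        uhtCharRow t (fun j => r (j + 1)) n := by
      ext1 i j
      refine Fin.cases ?_ (fun i => ?_) i
      · simp [uhtCharRow]
      · simp [uhtCharRow, uhtCharEntry_succ_succ]
    rw [h₁, h₂]
    simp [uhtCharRow, uhtCharEntry]
  · intro i _
    simp [uhtCharRow, uhtCharEntry]

theorem coeffDominated_uhtCharEntry_zero {t : ℕ → ℝ} {a : ℝ} (ht : ∀ k, |t k| ≤ -a) (j : ℕ) :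
    CoeffDominated (uhtCharEntry t 0 j) (uhtCharEntry (fun _ => a) 0 j) := by
  have hX : CoeffDominated (if 0 = j then X else 0) (if 0 = j then X else 0) := fun k => by
    split_ifs
    · rw [coeff_X]
      split_ifs <;> simp
    · simp
  have hC : CoeffDominated (-C (t (j + 1))) (-C a) := fun k => by
    simp only [coeff_neg, coeff_C, abs_neg]
    split_ifs
    · exact ht _
    · simp
  simpa [uhtCharEntry, sub_eq_add_neg] using hX.add hC

theorem coeffDominated_det_uhtCharRow {t : ℕ → ℝ} {a : ℝ} (ht : ∀ k, |t k| ≤ -a) (n : ℕ) :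
    ∀ {r s : ℕ → ℝ[X]}, (∀ j, CoeffDominated (r j) (s j)) →
      CoeffDominated (uhtCharRow t r n).det (uhtCharRow (fun _ => a) s n).det := by
  induction n with
  | zero =>
    intro r s h
    simpa only [det_uhtCharRow_zero] using h 0
  | succ n ih =>
    intro r s h
    rw [det_uhtCharRow_succ, det_uhtCharRow_succ]
    exact ((h 0).mul (ih (coeffDominated_uhtCharEntry_zero ht))).add (ih fun j => h (j + 1))

theorem bddAbove_range_abs_coeff (p : ℝ[X]) : BddAbove (Set.range fun k => |p.coeff k|) := by
  refine ⟨∑ i ∈ p.support, |p.coeff i|, ?_⟩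
  rintro _ ⟨k, rfl⟩
  by_cases hk : k ∈ p.support
  · exact Finset.single_le_sum (f := fun i => |p.coeff i|) (fun i _ => abs_nonneg _) hk
  · simpa [notMem_support_iff.mp hk] using Finset.sum_nonneg fun i _ => abs_nonneg (p.coeff i)

theorem CoeffDominated.heightR_le {p q : ℝ[X]} (h : CoeffDominated p q) :
    heightR p ≤ heightR q :=
  ciSup_mono (bddAbove_range_abs_coeff q) fun k => (h k).trans (le_abs_self _)

theorem uht_maximal_height_min_dominates (F : Finset ℝ) (hF : 2 ≤ F.card)
    (hne : F.Nonempty) (a b : ℝ) (ha : a = F.min' hne) (hb : b = F.max' hne)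
    (hab : |b| ≤ |a|) (n : ℕ) (hn : 1 ≤ n) (t : ℕ → ℝ) (ht : ∀ k, t k ∈ F) :
    heightR (uhtR t n).charpoly ≤ heightR (uhtR (fun _ => a) n).charpoly := by
  have hlt : a < b := by
    rw [ha, hb]
    exact Finset.min'_lt_max'_of_card F (by omega)
  have ha0 : a < 0 := by
    by_contra! h
    rw [abs_of_nonneg h, abs_of_nonneg (h.trans hlt.le)] at hab
    linarith
  have hbound : ∀ k, |t k| ≤ -a := fun k => by
    have h₁ : a ≤ t k := ha ▸ F.min'_le _ (ht k)
    have h₂ : t k ≤ b := hb ▸ F.le_max' _ (ht k)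
    rw [abs_of_neg ha0] at hab
    exact abs_le.mpr ⟨by linarith, by linarith [le_abs_self b]⟩
  obtain ⟨m, rfl⟩ := Nat.exists_eq_add_of_le' hn
  rw [charpoly_uhtR_succ, charpoly_uhtR_succ]
  exact (coeffDominated_det_uhtCharRow hbound m
    (coeffDominated_uhtCharEntry_zero hbound)).heightR_le
end

section
/- Let M̃_n = M_n(t₋) where t₋(k) = −1 for all k. Then for every n ≥ 1 the constant coefficient of the characteristic polynomial of M̃_n equals 2^{n−1}; that is, p_{n,0} = Σ_{k=1}^{n} p_{n−k,0} = 2^{n−1} with p_{0,0} = 1. In particular, the maximal characteristic height over t with values in {−1,0,+1} is at least 2^{n−1}, so it grows at least exponentially in n. -/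
open Polynomial Matrix Finset

/-- The height of an integer polynomial: the maximum of the absolute values of
its coefficients. -/
def heightZ (p : Polynomial ℤ) : ℕ :=
  p.support.sup fun k => (p.coeff k).natAbs

lemma coeff_natAbs_le_heightZ (p : Polynomial ℤ) (k : ℕ) :
    (p.coeff k).natAbs ≤ heightZ p := by
  by_cases hk : k ∈ p.support
  · exact Finset.le_sup (f := fun k => (p.coeff k).natAbs) hk
  · simp [Polynomial.notMem_support_iff.mp hk]

lemma charpoly_coeff_zero_eq_det_neg {n : ℕ} (M : Matrix (Fin n) (Fin n) ℤ) :
    M.charpoly.coeff 0 = (-M).det := by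
  rw [Polynomial.coeff_zero_eq_eval_zero, Matrix.eval_charpoly, map_zero, zero_sub]

/-- Subtracting the second row from the first leaves only the corner entry `2` in the first row. -/
lemma det_neg_uht_neg_one_succ_succ (n : ℕ) :
    (-uht (fun _ => -1) (n + 2)).det = 2 * (-uht (fun _ => -1) (n + 1)).det := by
  have hsub : (-uht (fun _ => -1) (n + 2)).submatrix Fin.succ Fin.succ =
      -uht (fun _ => -1) (n + 1) := by
    ext i j
    simp [uht]
  rw [← Matrix.det_updateRow_add_smul_self (-uht (fun _ => -1) (n + 2))
    (zero_ne_one : (0 : Fin (n + 2)) ≠ 1) (-1), Matrix.det_succ_row_zero, Fin.sum_univ_succ,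
    Finset.sum_eq_zero, ← Fin.succAbove_zero, Matrix.submatrix_updateRow_succAbove,
    Fin.succAbove_zero, hsub]
  · simp [uht]
  · intro j _
    have hj : (1 : Fin (n + 2)) ≤ j.succ := Fin.one_le_of_ne_zero (Fin.succ_ne_zero j)
    simp [uht, hj]

lemma uht_neg_one_charpoly_coeff_zero_succ (n : ℕ) :
    (uht (fun _ => -1) (n + 1)).charpoly.coeff 0 = 2 ^ n := by
  rw [charpoly_coeff_zero_eq_det_neg]
  induction n with
  | zero => simp [uht]
  | succ n ih => rw [det_neg_uht_neg_one_succ_succ, ih, pow_succ']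

lemma sum_range_uht_neg_one_charpoly_coeff_zero (n : ℕ) :
    ∑ i ∈ Finset.range (n + 1), (uht (fun _ => -1) i).charpoly.coeff 0 = 2 ^ n := by
  induction n with
  | zero => simp [charpoly_coeff_zero_eq_det_neg]
  | succ n ih =>
    rw [Finset.sum_range_succ, ih, uht_neg_one_charpoly_coeff_zero_succ, pow_succ, mul_two]

lemma sum_Icc_one_sub {M : Type*} [AddCommMonoid M] (f : ℕ → M) (n : ℕ) :
    ∑ k ∈ Finset.Icc 1 n, f (n - k) = ∑ i ∈ Finset.range n, f i :=
  Finset.sum_nbij' (fun k => n - k) (fun i => n - i)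
    (by simp; omega) (by simp; omega) (by simp; omega) (by simp; omega) (by simp)

/-- For `M̃_n = uht (fun _ => -1) n`: the constant coefficient satisfies the recurrence
`p_{n,0} = Σ_{k=1}^n p_{n-k,0}`, equals `2^{n-1}`, and in particular the maximal
characteristic height over `t` with values in `{-1,0,+1}` is at least `2^{n-1}`. -/
theorem uht_constant_coeff_two_pow (n : ℕ) (hn : 1 ≤ n) :
    ((uht (fun _ => -1) n).charpoly).coeff 0 =
      ∑ k ∈ Finset.Icc 1 n, ((uht (fun _ => -1) (n - k)).charpoly).coeff 0 ∧
    ((uht (fun _ => -1) n).charpoly).coeff 0 = 2 ^ (n - 1) ∧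
    ∀ τ : ℕ, (∀ t : ℕ → ℤ, (∀ k, t k ∈ ({-1, 0, 1} : Set ℤ)) →
        heightZ (uht t n).charpoly ≤ τ) →
      2 ^ (n - 1) ≤ τ := by
  obtain ⟨m, rfl⟩ := Nat.exists_eq_add_of_le' hn
  have hcoeff := uht_neg_one_charpoly_coeff_zero_succ m
  refine ⟨?_, hcoeff, fun τ hτ => ?_⟩
  · rw [hcoeff, sum_Icc_one_sub (fun i => (uht (fun _ => -1) i).charpoly.coeff 0),
      sum_range_uht_neg_one_charpoly_coeff_zero]
  · have hle := (coeff_natAbs_le_heightZ _ 0).trans (hτ (fun _ => -1) (by simp))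
    rwa [hcoeff, Int.natAbs_pow] at hle
end

section
/- Let M̃_n = M_n(t₋) where t₋(k) = −1 for all k, and write its characteristic polynomial as P_n(z) = Σ_{k=0}^{n} p_{n,k} z^k. Then p_{n,j} > 0 for all n ≥ 0 and all 0 ≤ j ≤ n; in particular every coefficient of the characteristic polynomial of M̃_n is a positive integer. -/
open Polynomial Matrix Finset

theorem charmatrix_uht_neg_one_apply (n : ℕ) (i j : Fin n) :
    (uht (fun _ => -1) n).charmatrix i j =
      if (i : ℕ) < j then 1 else if (i : ℕ) = j then X + 1
        else if (i : ℕ) = j + 1 then -1 else (0 : ℤ[X]) := by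
  rw [charmatrix_apply]
  by_cases h : i = j
  · subst h
    simp [uht]
  · have h' : (i : ℕ) ≠ j := fun e => h (Fin.ext e)
    rw [diagonal_apply_ne _ h]
    simp only [uht, of_apply]
    split_ifs <;> first | omega | simp

/-- Deleting the first row and column of the characteristic matrix leaves the characteristic
matrix of the next smaller size. -/
theorem charmatrix_uht_neg_one_submatrix (n : ℕ) :
    (uht (fun _ => -1) (n + 1)).charmatrix.submatrix Fin.succ Fin.succ =
      (uht (fun _ => -1) n).charmatrix := by
  ext1 i j
  simp only [submatrix_apply, charmatrix_uht_neg_one_apply, Fin.val_succ, Nat.add_lt_add_iff_right,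
    Nat.add_right_cancel_iff]

theorem charmatrix_uht_neg_one_det_minor (n : ℕ) :
    ((uht (fun _ => -1) (n + 2)).charmatrix.submatrix Fin.succ (Fin.succAbove 1)).det =
      -(uht (fun _ => -1) n).charpoly := by
  rw [det_succ_column_zero, Fin.sum_univ_succ, Finset.sum_eq_zero, add_zero]
  · have h : ((uht (fun _ => -1) (n + 2)).charmatrix.submatrix Fin.succ
        (Fin.succAbove 1)).submatrix (Fin.succAbove 0) Fin.succ =
        (uht (fun _ => -1) n).charmatrix := by
      rw [← charmatrix_uht_neg_one_submatrix n, ← charmatrix_uht_neg_one_submatrix (n + 1)]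
      ext1 i j
      have hj : (1 : Fin (n + 2)).succAbove j.succ = j.succ.succ := by
        rw [← Fin.succ_zero_eq_one, Fin.succ_succAbove_succ, Fin.succAbove_zero]
      simp only [submatrix_apply, hj, Fin.succAbove_zero]
    rw [h, charpoly]
    simp [uht]
  · intro i _
    simp [uht]

theorem uht_neg_one_charpoly_add_two (n : ℕ) :
    (uht (fun _ => -1) (n + 2)).charpoly =
      (X + 2) * (uht (fun _ => -1) (n + 1)).charpoly - X * (uht (fun _ => -1) n).charpoly := by
  rw [charpoly, ← det_updateRow_add_smul_self _ (zero_ne_one : (0 : Fin (n + 2)) ≠ 1) (-1),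
    det_succ_row_zero, Fin.sum_univ_succ, Fin.sum_univ_succ, Finset.sum_eq_zero, add_zero]
  · have h (k : Fin (n + 2)) (v : Fin (n + 2) → ℤ[X]) :
        ((uht (fun _ => -1) (n + 2)).charmatrix.updateRow 0 v).submatrix Fin.succ k.succAbove =
          (uht (fun _ => -1) (n + 2)).charmatrix.submatrix Fin.succ k.succAbove := by
      ext1 i j
      simp [updateRow_apply]
    rw [h, h, Fin.succ_zero_eq_one, charmatrix_uht_neg_one_det_minor, Fin.succAbove_zero,
      charmatrix_uht_neg_one_submatrix, ← charpoly]
    simp [uht]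
    ring
  · intro i _
    have h0 : (uht (fun _ => -1) (n + 2)).charmatrix 0 i.succ.succ = 1 := by
      simp [charmatrix_uht_neg_one_apply, -charmatrix_apply_ne]
    have h1 : (uht (fun _ => -1) (n + 2)).charmatrix 1 i.succ.succ = 1 := by
      simp [charmatrix_uht_neg_one_apply, -charmatrix_apply_ne]
    simp [h0, h1]

theorem uht_neg_one_charpoly_zero : (uht (fun _ => -1) 0).charpoly = 1 := by
  simp [charpoly]

theorem uht_neg_one_charpoly_one : (uht (fun _ => -1) 1).charpoly = X + 1 := by
  simp [charpoly, uht]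

/-- The coefficients are nonnegative and increase with the size of the matrix. -/
theorem uht_neg_one_charpoly_coeff_nonneg_and_mono (n : ℕ) :
    (∀ j, 0 ≤ ((uht (fun _ => -1) n).charpoly).coeff j) ∧
      ∀ j, ((uht (fun _ => -1) n).charpoly).coeff j ≤
        ((uht (fun _ => -1) (n + 1)).charpoly).coeff j := by
  induction n with
  | zero =>
    rw [uht_neg_one_charpoly_zero, uht_neg_one_charpoly_one]
    constructor <;> intro j <;> simp only [coeff_add, coeff_one, coeff_X] <;>
      split_ifs <;> norm_num
  | succ n ih =>
    obtain ⟨h0, h1⟩ := ih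
    have h2 (j : ℕ) := (h0 j).trans (h1 j)
    refine ⟨h2, fun j => ?_⟩
    rw [uht_neg_one_charpoly_add_two, show ∀ p q : ℤ[X],
      (X + 2) * p - X * q = p + (p + X * (p - q)) by intro p q; ring]
    cases j with
    | zero =>
      have := h2 0
      simp only [coeff_add, coeff_X_mul_zero]
      linarith
    | succ j =>
      have := h2 (j + 1)
      have := h1 j
      simp only [coeff_add, coeff_X_mul, coeff_sub]
      linarith

theorem uht_neg_one_charpoly_coeff_pos (n j : ℕ) (hj : j ≤ n) :
    0 < ((uht (fun _ => -1) n).charpoly).coeff j := by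
  induction n, hj using Nat.le_induction with
  | base =>
    have h := (charpoly_monic (uht (fun _ => -1) j)).coeff_natDegree
    rw [charpoly_natDegree_eq_dim, Fintype.card_fin] at h
    rw [h]
    exact one_pos
  | succ n _ ih => exact ih.trans_le ((uht_neg_one_charpoly_coeff_nonneg_and_mono n).2 j)
end

section
/- For every n ≥ 1, i ≥ 0, the identity Σ_{k=1}^{n} C(i+1, k) · C(n−1, k−1) · 2^{n−k} = Σ_{j=0}^{n−1} C(n−1, j) · C(i+j+1, i) holds, where C(a,b) denotes the binomial coefficient. -/
open Finset

theorem sum_range_choose_mul_choose (m k : ℕ) :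
    ∑ j ∈ range (m + 1), m.choose j * j.choose k = m.choose k * 2 ^ (m - k) := by
  rcases lt_or_ge m k with h | h
  · rw [Nat.choose_eq_zero_of_lt h, zero_mul]
    refine sum_eq_zero fun j hj => ?_
    rw [Nat.choose_eq_zero_of_lt (n := j) (by grind), mul_zero]
  · obtain ⟨d, rfl⟩ := Nat.exists_eq_add_of_le h
    rw [add_assoc, sum_range_add, sum_eq_zero, zero_add, Nat.add_sub_cancel_left,
      ← Nat.sum_range_choose, mul_sum]
    · refine sum_congr rfl fun l _ => ?_
      rw [Nat.choose_mul (Nat.le_add_right k l), Nat.add_sub_cancel_left, Nat.add_sub_cancel_left]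
    · intro j hj
      rw [Nat.choose_eq_zero_of_lt (mem_range.1 hj), mul_zero]

theorem add_choose_succ_eq_sum_range {m j : ℕ} (a : ℕ) (hj : j ≤ m) :
    (a + j).choose (j + 1) = ∑ k ∈ range (m + 1), a.choose (k + 1) * j.choose k := by
  have hsub : range (j + 1) ⊆ range (m + 1) := range_subset_range.2 (by lia)
  rw [Nat.add_choose_eq, Nat.sum_antidiagonal_eq_sum_range_succ_mk, sum_range_succ',
    ← sum_subset hsub]
  · simp only [Nat.sub_zero, Nat.choose_succ_self, mul_zero, add_zero]
    refine sum_congr rfl fun k hk => ?_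
    rw [Nat.add_sub_add_right, Nat.choose_symm (by grind)]
  · intro k _ hk
    rw [Nat.choose_eq_zero_of_lt (n := j) (by grind), mul_zero]

theorem binomial_identity (n i : ℕ) (hn : 1 ≤ n) :
    ∑ k ∈ Finset.Icc 1 n, (i + 1).choose k * (n - 1).choose (k - 1) * 2 ^ (n - k) =
      ∑ j ∈ Finset.range n, (n - 1).choose j * (i + j + 1).choose i := by
  obtain ⟨m, rfl⟩ := Nat.exists_eq_add_of_le' hn
  have hL : ∑ k ∈ Icc 1 (m + 1), (i + 1).choose k * m.choose (k - 1) * 2 ^ (m + 1 - k) =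
      ∑ k ∈ range (m + 1), (i + 1).choose (k + 1) * (m.choose k * 2 ^ (m - k)) := by
    rw [← Ico_add_one_right_eq_Icc, sum_Ico_eq_sum_range]
    refine sum_congr rfl fun k _ => ?_
    rw [add_comm 1 k, Nat.add_sub_cancel, Nat.add_sub_add_right, mul_assoc]
  have hR : ∀ j ∈ range (m + 1), m.choose j * (i + j + 1).choose i =
      ∑ k ∈ range (m + 1), (i + 1).choose (k + 1) * (m.choose j * j.choose k) := by
    intro j hj
    rw [add_assoc, Nat.choose_symm_add, ← add_assoc, add_right_comm,
      add_choose_succ_eq_sum_range (i + 1) (Nat.lt_succ_iff.1 (mem_range.1 hj)), mul_sum]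
    exact sum_congr rfl fun k _ => by ring
  rw [Nat.add_sub_cancel, hL, sum_congr rfl hR, sum_comm]
  refine sum_congr rfl fun k _ => ?_
  rw [← mul_sum, sum_range_choose_mul_choose]
end

section
/- Let M̃_n = M_n(t₋) where t₋(k) = −1 for all k, let P_n(z) be the characteristic polynomial of M̃_n (with P_0 = 1), and let T_n(z) = Σ_{k=0}^{n} P_k(z). Then, working in the polynomial ring ℤ[z] and with the 2×2 matrix A = [[z, 1], [z, 2]] over ℤ[z], for every n ≥ 0 the vector (P_n(z), T_n(z)) equals Aⁿ applied to the vector (1, 1). -/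
open Polynomial Matrix Finset

/-- `P n` is the characteristic polynomial of `M̃_n = uht (fun _ => -1) n`. -/
noncomputable def P (n : ℕ) : Polynomial ℤ := (uht (fun _ => -1) n).charpoly

/-- `T n = Σ_{k=0}^{n} P k`. -/
noncomputable def T (n : ℕ) : Polynomial ℤ := ∑ k ∈ Finset.range (n + 1), P k

/-- The upper Hessenberg matrix of size `n + 1` with top left entry `x`, the other diagonal
entries equal to `X + 1`, ones above the diagonal and `-1` on the subdiagonal. -/
noncomputable def hessenbergWithCorner (x : ℤ[X]) (n : ℕ) :
    Matrix (Fin (n + 1)) (Fin (n + 1)) ℤ[X] :=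
  Matrix.of fun i j =>
    if (i : ℕ) = j then if (i : ℕ) = 0 then x else X + 1
    else if (i : ℕ) < j then 1
    else if (i : ℕ) = j + 1 then -1 else 0

theorem P_succ_eq_det (n : ℕ) : P (n + 1) = (hessenbergWithCorner (X + 1) n).det := by
  rw [P, Matrix.charpoly]
  congr 1
  ext1 i j
  simp only [charmatrix_apply, uht, hessenbergWithCorner, of_apply, diagonal_apply, Fin.ext_iff]
  split_ifs <;> first | omega | simp

theorem det_hessenbergWithCorner_zero (x : ℤ[X]) : (hessenbergWithCorner x 0).det = x := by
  simp [hessenbergWithCorner]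

theorem det_hessenbergWithCorner_succ (x : ℤ[X]) (n : ℕ) :
    (hessenbergWithCorner x (n + 1)).det =
      x * (hessenbergWithCorner (X + 1) n).det + (hessenbergWithCorner 1 n).det := by
  have minor_zero : (hessenbergWithCorner x (n + 1)).submatrix (Fin.succAbove 0) Fin.succ =
      hessenbergWithCorner (X + 1) n := by
    ext1 i j
    simp [hessenbergWithCorner]
  have minor_one : (hessenbergWithCorner x (n + 1)).submatrix
      (Fin.succAbove (Fin.succ 0)) Fin.succ = hessenbergWithCorner 1 n := by
    ext1 i j
    refine Fin.cases ?_ (fun i => ?_) i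
    · simp [hessenbergWithCorner]
      grind
    · rw [submatrix_apply, Fin.succ_succAbove_succ]
      simp [hessenbergWithCorner]
  rw [det_succ_column_zero, Fin.sum_univ_succ, Fin.sum_univ_succ, minor_zero, minor_one]
  simp [hessenbergWithCorner]

theorem T_succ (n : ℕ) : T (n + 1) = T n + P (n + 1) := sum_range_succ _ _

theorem P_zero : P 0 = 1 := by simp [P]

theorem T_zero : T 0 = 1 := by simp [T, P_zero]

theorem T_eq_det (n : ℕ) : T n = (hessenbergWithCorner 1 n).det := by
  induction n with
  | zero => rw [T_zero, det_hessenbergWithCorner_zero]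
  | succ n ih => rw [T_succ, ih, P_succ_eq_det, det_hessenbergWithCorner_succ]; ring

theorem P_succ (n : ℕ) : P (n + 1) = X * P n + T n := by
  cases n with
  | zero => rw [P_succ_eq_det, det_hessenbergWithCorner_zero, P_zero, T_zero, mul_one]
  | succ n =>
    rw [T_succ, P_succ_eq_det (n + 1), det_hessenbergWithCorner_succ, ← P_succ_eq_det, ← T_eq_det]
    ring

theorem uht_neg_one_matrix_power_formula (n : ℕ) :
    ![P n, T n] =
      ((!![Polynomial.X, 1; Polynomial.X, 2] : Matrix (Fin 2) (Fin 2) (Polynomial ℤ)) ^ n).mulVec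
        ![1, 1] := by
  induction n with
  | zero => simp [P_zero, T_zero]
  | succ n ih =>
    rw [pow_succ', ← mulVec_mulVec, ← ih, T_succ, P_succ]
    ext1 i
    fin_cases i
    · simp [mulVec, dotProduct]
    · simp [mulVec, dotProduct]
      ring
end

section
/- Let M̃_n = M_n(t₋) where t₋(k) = −1 for all k, and let P_n(z) be the characteristic polynomial of M̃_n. Let z ∈ ℂ with z² ≠ −4, let Δ be a complex number with Δ² = 1 + z²/4 (so Δ ≠ 0), and set λ₊ = 1 + z/2 + Δ and λ₋ = 1 + z/2 − Δ. Then for every n ≥ 0, P_n(z) = λ₊ⁿ·(1/2 + z/(4Δ)) + λ₋ⁿ·(1/2 − z/(4Δ)). -/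
open Polynomial Matrix Finset

/-- The characteristic matrix `x • 1 - uht (fun _ => -1) n` with a parameter `x` from a
commutative ring in place of the polynomial variable. -/
def uhtNegOneCharmatrix {R : Type*} [CommRing R] (x : R) (n : ℕ) : Matrix (Fin n) (Fin n) R :=
  Matrix.of fun i j =>
    if (i : ℕ) = (j : ℕ) then x + 1
    else if (i : ℕ) < (j : ℕ) then 1
    else if (i : ℕ) = (j : ℕ) + 1 then -1 else 0

theorem charmatrix_uht_neg_one (n : ℕ) :
    (uht (fun _ => -1) n).charmatrix = uhtNegOneCharmatrix (X : ℤ[X]) n := by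
  ext1 i j
  rw [Matrix.charmatrix_apply, Matrix.diagonal_apply]
  simp only [uht, uhtNegOneCharmatrix, Matrix.of_apply, Fin.ext_iff]
  split_ifs <;> first | omega | simp

theorem uhtNegOneCharmatrix_submatrix_succ {R : Type*} [CommRing R] (x : R) (n : ℕ) :
    (uhtNegOneCharmatrix x (n + 1)).submatrix Fin.succ Fin.succ = uhtNegOneCharmatrix x n := by
  ext i j
  simp [uhtNegOneCharmatrix]

theorem det_uhtNegOneCharmatrix_minor {R : Type*} [CommRing R] (x : R) (n : ℕ) :
    ((uhtNegOneCharmatrix x (n + 2)).submatrix Fin.succ (Fin.succAbove 1)).det =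
      -(uhtNegOneCharmatrix x n).det := by
  have hminor : ((uhtNegOneCharmatrix x (n + 2)).submatrix Fin.succ (Fin.succAbove 1)).submatrix
      Fin.succ Fin.succ = uhtNegOneCharmatrix x n := by
    ext i j
    simp [uhtNegOneCharmatrix]
  rw [Matrix.det_succ_column_zero, Fin.sum_univ_succ, Finset.sum_eq_zero]
  · rw [Fin.succAbove_zero, hminor]
    simp [uhtNegOneCharmatrix]
  · intro i _
    simp [uhtNegOneCharmatrix]

/-- Subtracting the second row from the first leaves `(x + 2, -x, 0, …, 0)` in the first row. -/
theorem det_uhtNegOneCharmatrix_add_two {R : Type*} [CommRing R] (x : R) (n : ℕ) :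
    (uhtNegOneCharmatrix x (n + 2)).det =
      (x + 2) * (uhtNegOneCharmatrix x (n + 1)).det - x * (uhtNegOneCharmatrix x n).det := by
  have hsub (f : Fin (n + 1) → Fin (n + 2)) (v : Fin (n + 2) → R) :
      ((uhtNegOneCharmatrix x (n + 2)).updateRow 0 v).submatrix Fin.succ f =
        (uhtNegOneCharmatrix x (n + 2)).submatrix Fin.succ f := by
    ext i j
    simp [Matrix.updateRow_apply]
  rw [← Matrix.det_updateRow_add_smul_self (uhtNegOneCharmatrix x (n + 2))
    (i := 0) (j := 1) (by simp) (-1), Matrix.det_succ_row_zero, Fin.sum_univ_succ,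
    Fin.sum_univ_succ, Finset.sum_eq_zero]
  · simp only [hsub, Fin.succAbove_zero, uhtNegOneCharmatrix_submatrix_succ, Fin.succ_zero_eq_one,
      det_uhtNegOneCharmatrix_minor]
    simp [uhtNegOneCharmatrix]
    ring
  · intro j _
    have hj : (1 : Fin (n + 2)) < j.succ.succ := by simp [Fin.lt_def]
    simp [uhtNegOneCharmatrix, hj]

theorem uht_neg_one_charpoly_eval_closed_form (z : ℂ) (hz : z ^ 2 ≠ -4)
    (Δ : ℂ) (hΔ : Δ ^ 2 = 1 + z ^ 2 / 4) (n : ℕ) :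
    (Polynomial.aeval z (uht (fun _ => -1) n).charpoly : ℂ) =
      (1 + z / 2 + Δ) ^ n * (1 / 2 + z / (4 * Δ)) +
        (1 + z / 2 - Δ) ^ n * (1 / 2 - z / (4 * Δ)) := by
  have hΔ0 : Δ ≠ 0 := by
    rintro rfl
    exact hz (by linear_combination -4 * hΔ)
  rw [Matrix.charpoly, charmatrix_uht_neg_one]
  induction n using Nat.twoStepInduction with
  | zero => simp; ring
  | one =>
    simp [uhtNegOneCharmatrix]
    field_simp
    ring
  | more n ih₀ ih₁ =>
    rw [det_uhtNegOneCharmatrix_add_two]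
    simp only [map_sub, map_mul, map_add, Polynomial.aeval_X, map_ofNat, ih₀, ih₁]
    generalize z / (4 * Δ) = c
    linear_combination (-(1 + z / 2 + Δ) ^ n * (1 / 2 + c) -
      (1 + z / 2 - Δ) ^ n * (1 / 2 - c)) * hΔ
end

section
/- Let R be a commutative ring and t : ℕ → R. Let N_n be the n×n upper Hessenberg Toeplitz matrix over R with entries (N_n)_{i,j} = t(j−i+1) if j ≥ i, −1 if i = j+1, and 0 if i > j+1 (subdiagonal entries −1). Then for every n ≥ 1, det(N_n) = Σ over all compositions (c_1, …, c_m) of n of the product t(c_1)·t(c_2)⋯t(c_m), where a composition of n is a finite sequence of strictly positive integers summing to n. -/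
open Matrix Finset

/-- The `n × n` upper Hessenberg Toeplitz matrix over `R` with entries `t (j - i + 1)` on and
above the diagonal (1-based indexing), `-1` on the subdiagonal, and `0` below. -/
def uhtNeg {R : Type*} [CommRing R] (t : ℕ → R) (n : ℕ) : Matrix (Fin n) (Fin n) R :=
  Matrix.of fun i j =>
    if (i : ℕ) ≤ (j : ℕ) then t ((j : ℕ) - (i : ℕ) + 1)
    else if (i : ℕ) = (j : ℕ) + 1 then -1 else 0

/-- The matrix obtained from `uhtNeg t (n + 1)` by replacing its first row with
`f 0, f 1, …, f n`. -/
def uhtNegWithRow {R : Type*} [CommRing R] (t f : ℕ → R) (n : ℕ) :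
    Matrix (Fin (n + 1)) (Fin (n + 1)) R :=
  (uhtNeg t (n + 1)).updateRow 0 fun j => f j

theorem uhtNegWithRow_self {R : Type*} [CommRing R] (t : ℕ → R) (n : ℕ) :
    uhtNegWithRow t (fun k => t (k + 1)) n = uhtNeg t (n + 1) := by
  ext i j
  refine Fin.cases ?_ (fun i => ?_) i <;> simp [uhtNegWithRow, uhtNeg]

theorem uhtNegWithRow_det_succ {R : Type*} [CommRing R] (t f : ℕ → R) (n : ℕ) :
    (uhtNegWithRow t f (n + 1)).det =
      f 0 * (uhtNeg t (n + 1)).det + (uhtNegWithRow t (fun k => f (k + 1)) n).det := by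
  rw [Matrix.det_succ_column_zero, Fin.sum_univ_succ, Fin.sum_univ_succ, Finset.sum_eq_zero]
  · have h₀ : (uhtNegWithRow t f (n + 1)).submatrix (Fin.succAbove 0) Fin.succ =
        uhtNeg t (n + 1) := by
      ext i j
      simp [uhtNegWithRow, uhtNeg]
    have h₁ : (uhtNegWithRow t f (n + 1)).submatrix (Fin.succAbove (Fin.succ 0)) Fin.succ =
        uhtNegWithRow t (fun k => f (k + 1)) n := by
      ext i j
      refine Fin.cases ?_ (fun i => ?_) i <;> simp [uhtNegWithRow, uhtNeg]
    rw [h₀, h₁]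
    simp [uhtNegWithRow, uhtNeg]
  · intro i _
    simp [uhtNegWithRow, uhtNeg]

theorem uhtNegWithRow_det {R : Type*} [CommRing R] (t f : ℕ → R) (n : ℕ) :
    (uhtNegWithRow t f n).det = ∑ k : Fin (n + 1), f k * (uhtNeg t (n - k)).det := by
  induction n generalizing f with
  | zero => simp [uhtNegWithRow]
  | succ n ih =>
    rw [uhtNegWithRow_det_succ, ih, Fin.sum_univ_succ (n := n + 1)]
    refine congrArg₂ _ rfl (Finset.sum_congr rfl fun k _ => ?_)
    rw [Fin.val_succ, Nat.add_sub_add_right]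

/-- The composition of `n + 1` with first block `k + 1` followed by the blocks of `c`. -/
def Composition.consBlock {n : ℕ} (k : Fin (n + 1)) (c : Composition (n - k)) :
    Composition (n + 1) where
  blocks := (k + 1 : ℕ) :: c.blocks
  blocks_pos := by
    intro i hi
    rcases List.mem_cons.mp hi with rfl | hi
    · omega
    · exact c.blocks_pos hi
  blocks_sum := by
    rw [List.sum_cons, c.blocks_sum]
    omega

theorem Composition.bijective_consBlock (n : ℕ) :
    Function.Bijective fun p : (Σ k : Fin (n + 1), Composition (n - k)) =>
      Composition.consBlock p.1 p.2 := by
  constructor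
  · rintro ⟨k, c⟩ ⟨l, d⟩ h
    have hb := congrArg Composition.blocks h
    simp only [consBlock, List.cons.injEq, Nat.add_right_cancel_iff] at hb
    obtain rfl := Fin.ext hb.1
    obtain rfl := Composition.ext hb.2
    rfl
  · rintro ⟨_ | ⟨b, l⟩, hpos, hsum⟩
    · simp at hsum
    · have hb : 0 < b := hpos (by simp)
      rw [List.sum_cons] at hsum
      refine ⟨⟨⟨b - 1, by omega⟩, ⟨l, fun h => hpos (by simp [h]), ?_⟩⟩, ?_⟩
      · change l.sum = n - (b - 1)
        omega
      · ext1
        simp [consBlock, Nat.sub_add_cancel hb]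

theorem Composition.sum_succ_prod_map_blocks {R : Type*} [CommSemiring R] (t : ℕ → R) (n : ℕ) :
    ∑ c : Composition (n + 1), (c.blocks.map t).prod =
      ∑ k : Fin (n + 1), t (k + 1) * ∑ c : Composition (n - k), (c.blocks.map t).prod := by
  rw [← (Composition.bijective_consBlock n).sum_comp, Fintype.sum_sigma]
  simp [consBlock, Finset.mul_sum]

/-- The determinant of the upper Hessenberg Toeplitz matrix with subdiagonal `-1` is the sum,
over all compositions `(c₁, …, c_m)` of `n`, of the products `t c₁ * t c₂ * ⋯ * t c_m`. -/
theorem uhtNeg_det_eq_sum_compositions {R : Type*} [CommRing R] (t : ℕ → R)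
    (n : ℕ) (hn : 1 ≤ n) :
    (uhtNeg t n).det = ∑ c : Composition n, (c.blocks.map t).prod := by
  clear hn
  induction n using Nat.strong_induction_on with
  | _ n ih =>
    cases n with
    | zero =>
      rw [Matrix.det_isEmpty, Fintype.sum_eq_single default]
      · simp [show (default : Composition 0).blocks = [] from rfl]
      · intro c hc
        exact absurd (Composition.ext ((c.blocks_eq_nil.mpr rfl).trans
          ((default : Composition 0).blocks_eq_nil.mpr rfl).symm)) hc
    | succ n =>
      rw [← uhtNegWithRow_self, uhtNegWithRow_det, Composition.sum_succ_prod_map_blocks]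
      exact Finset.sum_congr rfl fun k _ => by rw [ih (n - k) (by omega)]
end
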